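/- arXiv:1903.08886 — 2 statements merged into one kernel-verified Lean document; each statement's English description precedes it below -/
import Mathlib

section
/- Let σ > 1 be real and let x ≥ 1 be real. Then ζ(σ) − 1 ≤ x^{σ−1} · ∑_{n ∈ ℕ, n ≥ x} n^{−σ} ≤ ζ(σ), where the sum runs over all positive integers n with n ≥ x. -/
/-- ζ(σ) = ∑_{n=1}^∞ n^{−σ} for real σ. -/
noncomputable def zetaR (σ : ℝ) : ℝ := ∑' n : ℕ, ((n : ℝ) + 1) ^ (-σ)

/-- Repeating every term of a nonnegative summable series `d` times multiplies its sum by `d`. -/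
theorem hasSum_comp_div {h : ℕ → ℝ} (hh : Summable h) (h0 : 0 ≤ h) (d : ℕ) [NeZero d] :
    HasSum (fun m => h (m / d)) (d * ∑' k, h k) := by
  have h1 : HasSum (fun _ : Fin d => (1 : ℝ)) d := by
    simpa using hasSum_fintype (fun _ : Fin d => (1 : ℝ))
  have hp := hh.mul_of_nonneg h1.summable h0 (fun _ => zero_le_one)
  have key := (Nat.divModEquiv d).hasSum_iff.mpr (hh.hasSum.mul h1 hp)
  rw [mul_comm]
  refine key.congr_fun ?_
  intro m
  simp [Nat.divModEquiv]

theorem summable_add_one_rpow_neg {σ : ℝ} (hσ : 1 < σ) :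
    Summable fun n : ℕ => ((n : ℝ) + 1) ^ (-σ) := by
  have := (summable_nat_add_iff 1).mpr (Real.summable_nat_rpow.mpr (by linarith : -σ < -1))
  simpa using this

theorem summable_tail_rpow_neg {σ : ℝ} (hσ : 1 < σ) (x : ℝ) :
    Summable fun n : ℕ => if x ≤ (n : ℝ) + 1 then ((n : ℝ) + 1) ^ (-σ) else 0 := by
  refine (summable_add_one_rpow_neg hσ).of_nonneg_of_le (fun n => ?_) (fun n => ?_)
  · split_ifs <;> positivity
  · split_ifs
    · exact le_rfl
    · positivity

theorem mul_tail_rpow_neg_le_zetaR {σ x : ℝ} (hσ : 1 < σ) (hx : 1 ≤ x) :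
    x ^ (σ - 1) * (∑' n : ℕ, (if x ≤ (n : ℝ) + 1 then ((n : ℝ) + 1) ^ (-σ) else 0)) ≤
      zetaR σ := by
  obtain ⟨d, hd⟩ : ∃ d, ⌈x⌉₊ = d + 1 :=
    Nat.exists_eq_succ_of_ne_zero (Nat.ceil_pos.mpr (by linarith)).ne'
  have hxd : x ≤ (d : ℝ) + 1 := by exact_mod_cast hd ▸ Nat.le_ceil x
  have hF := summable_tail_rpow_neg hσ x
  have hB := (hasSum_comp_div (summable_add_one_rpow_neg hσ)
    (fun n => by positivity) (d + 1)).mul_left (((d : ℝ) + 1) ^ (-σ))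
  have hzero : ∑ n ∈ Finset.range d,
      (if x ≤ (n : ℝ) + 1 then ((n : ℝ) + 1) ^ (-σ) else 0) = 0 := by
    refine Finset.sum_eq_zero fun n hn => if_neg fun hle => ?_
    have : ⌈x⌉₊ ≤ n + 1 := Nat.ceil_le.mpr (by exact_mod_cast hle)
    have := Finset.mem_range.mp hn
    omega
  have hT : (∑' n : ℕ, (if x ≤ (n : ℝ) + 1 then ((n : ℝ) + 1) ^ (-σ) else 0)) ≤
      ((d : ℝ) + 1) ^ (-σ) * (((d + 1 : ℕ) : ℝ) * zetaR σ) := by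
    rw [← hF.sum_add_tsum_nat_add d, hzero, zero_add]
    refine hasSum_le (fun m => ?_) ((summable_nat_add_iff d).mpr hF).hasSum hB
    have hle : ((d : ℝ) + 1) * (((m / (d + 1) : ℕ) : ℝ) + 1) ≤ ((m + d : ℕ) : ℝ) + 1 := by
      have := Nat.mul_div_le m (d + 1)
      have h2 : (d + 1) * (m / (d + 1) + 1) ≤ m + d + 1 := by rw [mul_add]; omega
      exact_mod_cast h2
    rw [← Real.mul_rpow (by positivity) (by positivity)]
    split_ifs
    · exact Real.rpow_le_rpow_of_nonpos (by positivity) hle (by linarith)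
    · positivity
  have hz : 0 ≤ zetaR σ := tsum_nonneg fun n => by positivity
  calc _ ≤ ((d : ℝ) + 1) ^ (σ - 1) *
        (((d : ℝ) + 1) ^ (-σ) * (((d + 1 : ℕ) : ℝ) * zetaR σ)) := by
        refine mul_le_mul (Real.rpow_le_rpow (by linarith) hxd (by linarith)) hT
          (tsum_nonneg fun n => ?_) (by positivity)
        split_ifs <;> positivity
    _ = zetaR σ := by
        rw [← mul_assoc, ← Real.rpow_add (by positivity),
          show σ - 1 + -σ = -1 by ring, Real.rpow_neg_one]
        push_cast
        field_simp

theorem zetaR_sub_one_le_mul_tail_rpow_neg {σ x : ℝ} (hσ : 1 < σ) (hx : 1 ≤ x) :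
    zetaR σ - 1 ≤
      x ^ (σ - 1) * ∑' n : ℕ, (if x ≤ (n : ℝ) + 1 then ((n : ℝ) + 1) ^ (-σ) else 0) := by
  obtain ⟨d, hd⟩ : ∃ d, ⌊x⌋₊ = d := ⟨_, rfl⟩
  have hd0 : 0 < d := hd ▸ Nat.floor_pos.mpr hx
  have : NeZero d := ⟨hd0.ne'⟩
  have hdR : (0 : ℝ) < d := by exact_mod_cast hd0
  have hdx : (d : ℝ) ≤ x := hd ▸ Nat.floor_le (by linarith)
  have hxd : x < (d : ℝ) + 1 := hd ▸ Nat.lt_floor_add_one x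
  have hF := summable_tail_rpow_neg hσ x
  have hs := summable_add_one_rpow_neg hσ
  have hz : zetaR σ - 1 = ∑' k : ℕ, (((k + 1 : ℕ) : ℝ) + 1) ^ (-σ) := by
    rw [zetaR, hs.tsum_eq_zero_add]
    simp
  have hB := (hasSum_comp_div ((summable_nat_add_iff 1).mpr hs)
    (fun n => by positivity) d).mul_left ((d : ℝ) ^ (-σ))
  rw [← hz] at hB
  have hT : (d : ℝ) ^ (-σ) * ((d : ℝ) * (zetaR σ - 1)) ≤
      ∑' n : ℕ, (if x ≤ (n : ℝ) + 1 then ((n : ℝ) + 1) ^ (-σ) else 0) := by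
    rw [← hF.sum_add_tsum_nat_add d]
    refine le_add_of_nonneg_of_le (Finset.sum_nonneg fun n _ => ?_) ?_
    · split_ifs <;> positivity
    refine hasSum_le (fun m => ?_) hB ((summable_nat_add_iff d).mpr hF).hasSum
    have hle : ((m + d : ℕ) : ℝ) + 1 ≤ (d : ℝ) * (((m / d + 1 : ℕ) : ℝ) + 1) := by
      have := Nat.lt_mul_div_succ m hd0
      have h2 : m + d + 1 ≤ d * (m / d + 1 + 1) := by rw [mul_add _ (m / d + 1)]; omega
      exact_mod_cast h2
    rw [← Real.mul_rpow (by positivity) (by positivity), if_pos]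
    · exact Real.rpow_le_rpow_of_nonpos (by positivity) hle (by linarith)
    · push_cast
      linarith [(m.cast_nonneg : (0 : ℝ) ≤ m)]
  have hz0 : 0 ≤ zetaR σ - 1 := hz ▸ tsum_nonneg fun n => by positivity
  calc zetaR σ - 1 = (d : ℝ) ^ (σ - 1) * ((d : ℝ) ^ (-σ) * ((d : ℝ) * (zetaR σ - 1))) := by
        rw [← mul_assoc, ← Real.rpow_add hdR,
          show σ - 1 + -σ = -1 by ring, Real.rpow_neg_one]
        field_simp
    _ ≤ _ := by
        refine mul_le_mul (Real.rpow_le_rpow hdR.le hdx (by linarith)) hT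
          (by positivity) (by positivity)

/-- For σ > 1 and x ≥ 1: ζ(σ) − 1 ≤ x^{σ−1} · ∑_{n ≥ x} n^{−σ} ≤ ζ(σ),
the sum running over all positive integers n with n ≥ x. -/
theorem stmt1 (σ x : ℝ) (hσ : 1 < σ) (hx : 1 ≤ x) :
    zetaR σ - 1 ≤
      x ^ (σ - 1) * ∑' n : ℕ, (if x ≤ (n : ℝ) + 1 then ((n : ℝ) + 1) ^ (-σ) else 0) ∧
    x ^ (σ - 1) * (∑' n : ℕ, (if x ≤ (n : ℝ) + 1 then ((n : ℝ) + 1) ^ (-σ) else 0)) ≤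
      zetaR σ := by
  exact ⟨zetaR_sub_one_le_mul_tail_rpow_neg hσ hx, mul_tail_rpow_neg_le_zetaR hσ hx⟩
end

section
/- Let c ∈ ℂ with Re c > 1/2, let (c_j)_{j≥1} be complex numbers with r := ∑_{j≥1} |c_j| satisfying 0 < r ≤ Re c − 1/2, and set C = (∑_{j≥1} |c_j|²)/r² and ξ = (Re c − 1/2) + √((Re c − 1/2)² − r²). For each integer k ≥ 0 let M_k = ∑_α (k!/∏_j α_j!)² · ∏_j |c_j|^{2α_j}, the sum over all finitely supported multi-indices α : ℕ → ℕ with ∑_j α_j = k. Then for every square-summable sequence (a_n)_{n≥1} of complex numbers, ∑_{k=0}^∞ (1/(k!)²)·|∑_{n=1}^∞ a_n (−log n)^k n^{−c}|² · M_k ≤ [(1−C)·ζ(2 Re c) + C·ζ(1+ξ)]·∑_{n=1}^∞ |a_n|². -/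
/-- `MkInf cj k = ∑_α (k!/∏_j α_j!)² · ∏_j |c_j|^{2α_j}`, the sum over all finitely
supported multi-indices α : ℕ → ℕ with ∑_j α_j = k. -/
noncomputable def MkInf (cj : ℕ → ℂ) (k : ℕ) : ℝ :=
  ∑' α : {α : ℕ →₀ ℕ // (α.sum fun _ v => v) = k},
    ((k.factorial : ℝ) / (α : ℕ →₀ ℕ).prod fun _ v => (v.factorial : ℝ)) ^ 2 *
      (α : ℕ →₀ ℕ).prod fun j v => ‖cj j‖ ^ (2 * v)

open scoped ENNReal
open MeasureTheory

theorem ENNReal.two_mul_mul_le_sq_add_sq (a b : ℝ≥0∞) : 2 * a * b ≤ a ^ 2 + b ^ 2 := by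
  rcases eq_or_ne a ⊤ with rfl | ha
  · simp
  rcases eq_or_ne b ⊤ with rfl | hb
  · simp
  lift a to NNReal using ha
  lift b to NNReal using hb
  exact_mod_cast _root_.two_mul_le_add_sq a b

/-- The Cauchy-Schwarz inequality for weighted sums in `ℝ≥0∞`. -/
theorem ENNReal.tsum_mul_sq_le {ι : Type*} (p g : ι → ℝ≥0∞) :
    (∑' i, p i * g i) ^ 2 ≤ (∑' i, p i) * ∑' i, p i * g i ^ 2 := by
  have h1 : (∑' i, p i * g i) ^ 2 = ∑' i, ∑' j, (p i * p j) * (g i * g j) := by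
    rw [sq, ← ENNReal.tsum_mul_right]
    refine tsum_congr fun i => ?_
    rw [← ENNReal.tsum_mul_left]
    exact tsum_congr fun j => by ring
  have h2 : (∑' i, p i) * ∑' i, p i * g i ^ 2 = ∑' i, ∑' j, (p i * p j) * g j ^ 2 := by
    rw [← ENNReal.tsum_mul_right]
    refine tsum_congr fun i => ?_
    rw [← ENNReal.tsum_mul_left]
    exact tsum_congr fun j => by ring
  have h3 : (∑' i, p i) * ∑' i, p i * g i ^ 2 = ∑' i, ∑' j, (p i * p j) * g i ^ 2 := by
    rw [h2, ENNReal.tsum_comm]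
    exact tsum_congr fun i => tsum_congr fun j => by ring
  have h4 : 2 * (∑' i, p i * g i) ^ 2 ≤ 2 * ((∑' i, p i) * ∑' i, p i * g i ^ 2) := by
    rw [two_mul ((∑' i, p i) * _)]
    nth_rewrite 1 [h3]
    rw [h2, h1, ← ENNReal.tsum_add, ← ENNReal.tsum_mul_left]
    refine ENNReal.tsum_le_tsum fun i => ?_
    rw [← ENNReal.tsum_add, ← ENNReal.tsum_mul_left]
    refine ENNReal.tsum_le_tsum fun j => ?_
    calc 2 * (p i * p j * (g i * g j)) = p i * p j * (2 * g i * g j) := by ring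
      _ ≤ p i * p j * (g i ^ 2 + g j ^ 2) := by gcongr; exact ENNReal.two_mul_mul_le_sq_add_sq _ _
      _ = _ := by ring
  exact (ENNReal.mul_le_mul_iff_right (by norm_num) (by norm_num)).1 h4

/-- The tail `∑_{n ≥ N} n ^ (-s)` is at most `N ^ (1 - s) ζ(s)`. -/
theorem tsum_nat_add_rpow_le (s : ℝ) (hs : 0 ≤ s) (N : ℕ) (hN : 0 < N) :
    ∑' n : ℕ, ENNReal.ofReal (((n + N : ℕ) : ℝ) ^ (-s)) ≤
      ENNReal.ofReal ((N : ℝ) ^ (1 - s)) * ∑' n : ℕ, ENNReal.ofReal (((n : ℝ) + 1) ^ (-s)) := by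
  have : NeZero N := ⟨hN.ne'⟩
  have hN' : (0 : ℝ) < N := by exact_mod_cast hN
  rw [← (Nat.divModEquiv N).symm.tsum_eq, ENNReal.tsum_prod', ← ENNReal.tsum_mul_left]
  refine ENNReal.tsum_le_tsum fun q => ?_
  rw [tsum_fintype]
  calc _ ≤ ∑ _i : Fin N, ENNReal.ofReal ((N * ((q : ℝ) + 1)) ^ (-s)) := by
        refine Finset.sum_le_sum fun i _ => ENNReal.ofReal_le_ofReal ?_
        refine Real.rpow_le_rpow_of_nonpos (by positivity) ?_ (by linarith)
        simp only [Nat.divModEquiv_symm_apply]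
        push_cast
        nlinarith [(Nat.cast_nonneg (i : ℕ) : (0 : ℝ) ≤ _)]
    _ = _ := by
        rw [Finset.sum_const, Finset.card_univ, Fintype.card_fin, nsmul_eq_mul,
          ← ENNReal.ofReal_natCast, ← ENNReal.ofReal_mul (by positivity),
          ← ENNReal.ofReal_mul (by positivity), Real.mul_rpow (by positivity) (by positivity),
          ← mul_assoc, sub_eq_add_neg, Real.rpow_add hN', Real.rpow_one]

theorem tsum_rpow_ge_le (s : ℝ) (hs : 1 ≤ s) (x : ℝ) (hx : 1 ≤ x) :
    ∑' n : ℕ, ENNReal.ofReal (((n : ℝ) + 1) ^ (-s)) * (if x ≤ (n : ℝ) + 1 then 1 else 0) ≤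
      ENNReal.ofReal (x ^ (1 - s)) * ∑' n : ℕ, ENNReal.ofReal (((n : ℝ) + 1) ^ (-s)) := by
  obtain ⟨M, hM⟩ : ∃ M, ⌈x⌉₊ = M + 1 :=
    Nat.exists_eq_succ_of_ne_zero (Nat.ceil_pos.2 (by linarith)).ne'
  have hc : ∀ n : ℕ, x ≤ (n : ℝ) + 1 ↔ M ≤ n := fun n => by
    rw [← Nat.cast_add_one, ← Nat.ceil_le, hM]; omega
  rw [← Summable.sum_add_tsum_nat_add' (k := M) ENNReal.summable, Finset.sum_eq_zero, zero_add]
  · refine le_trans ?_ ((tsum_nat_add_rpow_le s (by linarith) (M + 1) M.succ_pos).trans ?_)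
    · refine ENNReal.tsum_le_tsum fun n => ?_
      rw [if_pos ((hc _).2 (by omega)), mul_one]
      push_cast
      rw [add_assoc]
    · gcongr ENNReal.ofReal ?_ * _
      refine Real.rpow_le_rpow_of_nonpos (by linarith) ?_ (by linarith)
      rw [← hM]; exact Nat.le_ceil x
  · intro n hn
    rw [if_neg, mul_zero]
    rw [hc]; simpa using hn

theorem lintegral_pow_exp (k : ℕ) (u : ℝ) (hu : 0 < u) :
    ∫⁻ t in Set.Ioi (0 : ℝ),
        ENNReal.ofReal (t ^ k / k.factorial) * ENNReal.ofReal (Real.exp (-(u * t)))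
      = ENNReal.ofReal (1 / u ^ (k + 1)) := by
  have h := Real.integral_rpow_mul_exp_neg_mul_Ioi (a := k + 1) (r := u) (by positivity) hu
  have hne : ∫ t in Set.Ioi (0 : ℝ), t ^ ((k : ℝ) + 1 - 1) * Real.exp (-(u * t)) ≠ 0 := by
    rw [h, Real.Gamma_nat_eq_factorial]; positivity
  have hint : IntegrableOn (fun t : ℝ => t ^ ((k : ℝ) + 1 - 1) * Real.exp (-(u * t))) (Set.Ioi 0) := by
    by_contra hc
    exact hne (integral_undef hc)
  simp only [add_sub_cancel_right, Real.rpow_natCast] at h hint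
  have h2 : ∫ t in Set.Ioi (0 : ℝ), (t ^ k * Real.exp (-(u * t))) / k.factorial = 1 / u ^ (k + 1) := by
    rw [integral_div, h, Real.Gamma_nat_eq_factorial]
    have : (k.factorial : ℝ) ≠ 0 := by positivity
    rw [← Nat.cast_add_one, Real.rpow_natCast]
    rw [one_div_pow]
    field_simp
  rw [← h2, ofReal_integral_eq_lintegral_ofReal (hint.div_const _)]
  · refine setLIntegral_congr_fun measurableSet_Ioi fun t ht => ?_
    have : (0 : ℝ) < t := ht
    rw [← ENNReal.ofReal_mul (by positivity)]
    congr 1; ring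
  · filter_upwards [ae_restrict_mem measurableSet_Ioi] with t ht
    have : (0 : ℝ) < t := ht
    show (0 : ℝ) ≤ _
    positivity

theorem lintegral_pow_indicator (k : ℕ) (y : ℝ) (hy : 0 ≤ y) :
    ∫⁻ t in Set.Ioi (0 : ℝ), ENNReal.ofReal (t ^ k / k.factorial) * (if t ≤ y then 1 else 0)
      = ENNReal.ofReal (y ^ (k + 1) / (k + 1).factorial) := by
  have h : ∫ t in Set.Ioc 0 y, t ^ k / k.factorial = y ^ (k + 1) / (k + 1).factorial := by
    rw [← intervalIntegral.integral_of_le hy, intervalIntegral.integral_div, integral_pow,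
      Nat.factorial_succ]
    push_cast
    have : (k.factorial : ℝ) ≠ 0 := by positivity
    simp
    field_simp
  have hcont : Continuous fun t : ℝ => t ^ k / k.factorial := by fun_prop
  rw [← h, ofReal_integral_eq_lintegral_ofReal
    ((hcont.integrableOn_Icc (a := 0) (b := y)).mono_set Set.Ioc_subset_Icc_self)]
  · have : Set.Ioc 0 y = Set.Iic y ∩ Set.Ioi 0 := by ext; simp [and_comm]
    rw [this, ← Measure.restrict_restrict measurableSet_Iic, ← lintegral_indicator measurableSet_Iic]
    congr 1
    ext t
    by_cases h : t ≤ y <;> simp [Set.indicator, h]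
  · filter_upwards [ae_restrict_mem measurableSet_Ioc] with t ht
    have : (0 : ℝ) < t := ht.1
    show (0 : ℝ) ≤ _
    positivity

/-- `∑ n ^ (-s) (log n) ^ k / k! ≤ ζ(s) / (s - 1) ^ k`: a zeta-distributed integer is
stochastically dominated by a Pareto variable. -/
theorem tsum_log_pow_le (s : ℝ) (hs : 1 < s) (k : ℕ) :
    ∑' n : ℕ, ENNReal.ofReal (((n : ℝ) + 1) ^ (-s)) *
        ENNReal.ofReal (Real.log ((n : ℝ) + 1) ^ k / k.factorial) ≤
      ENNReal.ofReal (1 / (s - 1) ^ k) * ∑' n : ℕ, ENNReal.ofReal (((n : ℝ) + 1) ^ (-s)) := by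
  cases k with
  | zero => simp
  | succ k =>
    have hlog : ∀ n : ℕ, 0 ≤ Real.log ((n : ℝ) + 1) := fun n => Real.log_nonneg (by simp)
    simp_rw [← fun n : ℕ => lintegral_pow_indicator k _ (hlog n)]
    have hm : ∀ y : ℝ, Measurable fun t : ℝ =>
        ENNReal.ofReal (t ^ k / k.factorial) * (if t ≤ y then (1 : ℝ≥0∞) else 0) := fun y =>
      (by fun_prop : Measurable fun t : ℝ => ENNReal.ofReal (t ^ k / k.factorial)).mul
        (Measurable.ite measurableSet_Iic measurable_const measurable_const)
    simp_rw [← fun n : ℕ => lintegral_const_mul (μ := volume.restrict (Set.Ioi (0 : ℝ)))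
      (ENNReal.ofReal (((n : ℝ) + 1) ^ (-s))) (hm (Real.log ((n : ℝ) + 1)))]
    rw [← lintegral_tsum fun n => ((hm _).const_mul _).aemeasurable,
      ← lintegral_pow_exp k (s - 1) (by linarith), ← lintegral_mul_const _ (by fun_prop)]
    refine setLIntegral_mono (by fun_prop) fun t ht => ?_
    have ht : (0 : ℝ) < t := ht
    have h := tsum_rpow_ge_le s hs.le (Real.exp t) (Real.one_le_exp ht.le)
    rw [← Real.exp_mul, show t * (1 - s) = -((s - 1) * t) by ring] at h
    rw [mul_assoc]
    refine le_trans (le_of_eq ?_) (mul_le_mul_right h _)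
    rw [← ENNReal.tsum_mul_left]
    refine tsum_congr fun n => ?_
    rw [mul_left_comm]
    simp only [Real.le_log_iff_exp_le (show (0 : ℝ) < (n : ℝ) + 1 by positivity)]


/-- The term of the multinomial expansion of `(∑ j, q j) ^ |α|` with exponent `α`. -/
noncomputable def multinomialTerm (q : ℕ → ℝ) (α : ℕ →₀ ℕ) : ℝ :=
  α.degree.factorial * α.prod fun j v => q j ^ v / v.factorial

theorem multinomialTerm_nonneg (q : ℕ → ℝ) (hq : ∀ j, 0 ≤ q j) (α : ℕ →₀ ℕ) :
    0 ≤ multinomialTerm q α :=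
  mul_nonneg (by positivity) (Finset.prod_nonneg fun j _ => by have := hq j; positivity)

theorem prod_add_single (q : ℕ → ℝ) (β : ℕ →₀ ℕ) (j : ℕ) :
    ((β j : ℝ) + 1) * ((β + Finsupp.single j 1).prod fun j v => q j ^ v / (v.factorial : ℝ)) =
      q j * β.prod fun j v => q j ^ v / (v.factorial : ℝ) := by
  rw [← Finsupp.mul_prod_erase' (β + Finsupp.single j 1) j _ (by simp),
    ← Finsupp.mul_prod_erase' β j _ (by simp), Finsupp.erase_add, Finsupp.erase_single, add_zero]
  simp only [Finsupp.add_apply, Finsupp.single_eq_same, Nat.factorial_succ]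
  have : ((β j).factorial : ℝ) ≠ 0 := by positivity
  push_cast
  field_simp
  ring

/-- The Pascal recurrence for multinomial coefficients. -/
theorem multinomialTerm_eq_sum (q : ℕ → ℝ) (α : ℕ →₀ ℕ) (hα : α.degree ≠ 0) :
    multinomialTerm q α =
      ∑ j ∈ α.support, q j * multinomialTerm q (α - Finsupp.single j 1) := by
  obtain ⟨k, hk⟩ := Nat.exists_eq_succ_of_ne_zero hα
  have h : ∀ j ∈ α.support, q j * multinomialTerm q (α - Finsupp.single j 1) =
      α j * (k.factorial * α.prod fun j v => q j ^ v / (v.factorial : ℝ)) := by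
    intro j hj
    have hj' : 1 ≤ α j := Nat.one_le_iff_ne_zero.2 (Finsupp.mem_support_iff.1 hj)
    have hle : Finsupp.single j 1 ≤ α := Finsupp.single_le_iff.2 hj'
    have hadd : α - Finsupp.single j 1 + Finsupp.single j 1 = α := tsub_add_cancel_of_le hle
    have hd : (α - Finsupp.single j 1).degree = k := by
      have := congrArg Finsupp.degree hadd
      rw [map_add, Finsupp.degree_single, hk] at this
      omega
    have h1 := prod_add_single q (α - Finsupp.single j 1) j
    have h2 : (((α - Finsupp.single j 1 : ℕ →₀ ℕ) j : ℕ) : ℝ) + 1 = α j := by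
      simp only [Finsupp.tsub_apply, Finsupp.single_eq_same]
      rw [Nat.cast_sub hj']; simp
    rw [hadd, h2] at h1
    rw [multinomialTerm, hd]
    linear_combination -(k.factorial : ℝ) * h1
  rw [Finset.sum_congr rfl h, ← Finset.sum_mul, ← Nat.cast_sum, ← Finsupp.degree_apply,
    multinomialTerm, hk, Nat.factorial_succ]
  push_cast
  ring

/-- The sum of the squares of the terms in the multinomial expansion of `(∑ j, q j) ^ k`. -/
noncomputable def multinomialSq (q : ℕ → ℝ) (k : ℕ) : ℝ≥0∞ :=
  ∑' α : {α : ℕ →₀ ℕ // α.degree = k}, ENNReal.ofReal (multinomialTerm q α) ^ 2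

theorem multinomialSq_zero (q : ℕ → ℝ) : multinomialSq q 0 = 1 := by
  rw [multinomialSq, tsum_eq_single ⟨0, map_zero _⟩]
  · simp [multinomialTerm]
  · rintro ⟨α, hα⟩ hne
    exact absurd (Subtype.ext ((Finsupp.degree_eq_zero_iff α).1 hα)) hne

theorem multinomialSq_one (q : ℕ → ℝ) :
    multinomialSq q 1 = ∑' j, ENNReal.ofReal (q j) ^ 2 := by
  let e : ℕ → {α : ℕ →₀ ℕ // α.degree = 1} := fun j =>
    ⟨Finsupp.single j 1, Finsupp.degree_single _ _⟩
  have he : Function.Injective e := fun i j h =>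
    Finsupp.single_left_injective one_ne_zero (congrArg Subtype.val h)
  have hs : Function.Surjective e := by
    rintro ⟨α, hα⟩
    have : α ∈ Set.range fun a : ℕ => Finsupp.single a 1 := by
      rw [Finsupp.range_single_one]; exact hα
    obtain ⟨j, hj⟩ := this
    exact ⟨j, Subtype.ext hj⟩
  rw [multinomialSq, ← (Equiv.ofBijective e ⟨he, hs⟩).tsum_eq]
  refine tsum_congr fun j => ?_
  change ENNReal.ofReal (multinomialTerm q (Finsupp.single j 1)) ^ 2 = _
  simp [multinomialTerm]

theorem multinomialSq_succ_le (q : ℕ → ℝ) (hq : ∀ j, 0 ≤ q j) (k : ℕ) :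
    multinomialSq q (k + 1) ≤ (∑' j, ENNReal.ofReal (q j)) ^ 2 * multinomialSq q k := by
  classical
  set R := ∑' j, ENNReal.ofReal (q j) with hR
  let g : (ℕ →₀ ℕ) → ℕ → ℝ≥0∞ := fun α j =>
    if j ∈ α.support then ENNReal.ofReal (multinomialTerm q (α - Finsupp.single j 1)) else 0
  have h1 : ∀ α : {α : ℕ →₀ ℕ // α.degree = k + 1},
      ENNReal.ofReal (multinomialTerm q α) = ∑' j, ENNReal.ofReal (q j) * g α j := by
    rintro ⟨α, hα⟩
    rw [multinomialTerm_eq_sum q α (by omega), ENNReal.ofReal_sum_of_nonneg fun j _ =>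
      mul_nonneg (hq j) (multinomialTerm_nonneg q hq _), tsum_eq_sum (s := α.support)]
    · refine Finset.sum_congr rfl fun j hj => ?_
      simp only [g]
      rw [if_pos hj, ENNReal.ofReal_mul (hq j)]
    · intro j hj
      simp only [g]
      rw [if_neg hj, mul_zero]
  have h2 : ∀ j, ∑' α : {α : ℕ →₀ ℕ // α.degree = k + 1}, g α j ^ 2 = multinomialSq q k := by
    intro j
    let e : {α : ℕ →₀ ℕ // α.degree = k} → {α : ℕ →₀ ℕ // α.degree = k + 1} := fun β =>
      ⟨(β : ℕ →₀ ℕ) + Finsupp.single j 1, by rw [map_add, Finsupp.degree_single, β.2]⟩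
    have he : Function.Injective e := fun a b h =>
      Subtype.ext (add_right_cancel (b := Finsupp.single j 1) (congrArg Subtype.val h))
    rw [← he.tsum_eq]
    · refine tsum_congr fun β => ?_
      simp [e, g]
    · rintro ⟨α, hα⟩ hsupp
      have hj : j ∈ α.support := by
        by_contra hj
        refine hsupp ?_
        simp only [g]
        rw [if_neg hj]; simp
      have hadd : α - Finsupp.single j 1 + Finsupp.single j 1 = α :=
        tsub_add_cancel_of_le (Finsupp.single_le_iff.2
          (Nat.one_le_iff_ne_zero.2 (Finsupp.mem_support_iff.1 hj)))
      refine ⟨⟨α - Finsupp.single j 1, ?_⟩, Subtype.ext hadd⟩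
      have := congrArg Finsupp.degree hadd
      rw [map_add, Finsupp.degree_single, hα] at this
      omega
  calc multinomialSq q (k + 1)
      ≤ ∑' α : {α : ℕ →₀ ℕ // α.degree = k + 1}, R * ∑' j, ENNReal.ofReal (q j) * g α j ^ 2 := by
        refine ENNReal.tsum_le_tsum fun α => ?_
        rw [h1]
        exact ENNReal.tsum_mul_sq_le _ _
    _ = R * ∑' j, ENNReal.ofReal (q j) * multinomialSq q k := by
        rw [ENNReal.tsum_mul_left, ENNReal.tsum_comm]
        simp_rw [ENNReal.tsum_mul_left, h2]
    _ = _ := by rw [ENNReal.tsum_mul_right]; ring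

theorem multinomialSq_succ_le_pow (q : ℕ → ℝ) (hq : ∀ j, 0 ≤ q j) (k : ℕ) :
    multinomialSq q (k + 1) ≤
      (∑' j, ENNReal.ofReal (q j)) ^ (2 * k) * ∑' j, ENNReal.ofReal (q j) ^ 2 := by
  induction k with
  | zero => simp [multinomialSq_one]
  | succ k ih =>
    refine (multinomialSq_succ_le q hq _).trans ?_
    calc _ ≤ (∑' j, ENNReal.ofReal (q j)) ^ 2 * _ := mul_le_mul_right ih _
      _ = _ := by ring

theorem ofReal_tsum_le {ι : Type*} (f : ι → ℝ) (hf : ∀ i, 0 ≤ f i) :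
    ENNReal.ofReal (∑' i, f i) ≤ ∑' i, ENNReal.ofReal (f i) := by
  by_cases h : Summable f
  · exact (ENNReal.ofReal_tsum_of_nonneg hf h).le
  · simp [tsum_eq_zero_of_not_summable h]

theorem MkInf_le (cj : ℕ → ℂ) (k : ℕ) :
    ENNReal.ofReal (MkInf cj k) ≤ multinomialSq (fun j => ‖cj j‖) k := by
  have h : ∀ α : {α : ℕ →₀ ℕ // (α.sum fun _ v => v) = k},
      ((k.factorial : ℝ) / (α : ℕ →₀ ℕ).prod fun _ v => (v.factorial : ℝ)) ^ 2 *
        (α : ℕ →₀ ℕ).prod (fun j v => ‖cj j‖ ^ (2 * v)) =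
      multinomialTerm (fun j => ‖cj j‖) α ^ 2 := by
    rintro ⟨α, hα⟩
    have hα : α.degree = k := hα
    simp only [multinomialTerm, hα, Finsupp.prod, Finset.prod_div_distrib, mul_comm 2, pow_mul,
      Finset.prod_pow]
    ring
  rw [MkInf, tsum_congr h]
  refine (ofReal_tsum_le _ fun α => sq_nonneg _).trans (le_of_eq ?_)
  exact tsum_congr fun α =>
    ENNReal.ofReal_pow (multinomialTerm_nonneg _ (fun j => norm_nonneg _) _) 2

theorem MkInf_nonneg (cj : ℕ → ℂ) (k : ℕ) : 0 ≤ MkInf cj k :=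
  tsum_nonneg fun α => mul_nonneg (sq_nonneg _) (Finset.prod_nonneg fun j _ => by positivity)

/-- The squared `H²` norm of `f (σ + r z)` on the unit disc, with `f(s) = ∑ b_n n ^ (-s)`, is at
most `ζ(1 + ξ) ∑ b_n ^ 2`. -/
theorem tsum_taylor_sq_le (σ r : ℝ) (hσ : 1 / 2 < σ) (hr : 0 ≤ r) (hrσ : r ≤ σ - 1 / 2) (s : ℝ)
    (hs : s = 1 + (σ - 1 / 2 + Real.sqrt ((σ - 1 / 2) ^ 2 - r ^ 2))) (b : ℕ → ℝ≥0∞) :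
    ∑' k : ℕ, ENNReal.ofReal (r ^ (2 * k)) *
        (∑' n : ℕ, b n * ENNReal.ofReal (((n : ℝ) + 1) ^ (-σ)) *
          ENNReal.ofReal (Real.log ((n : ℝ) + 1) ^ k / k.factorial)) ^ 2 ≤
      (∑' n : ℕ, ENNReal.ofReal (((n : ℝ) + 1) ^ (-s))) * ∑' n, b n ^ 2 := by
  have hsq := Real.sqrt_nonneg ((σ - 1 / 2) ^ 2 - r ^ 2)
  have hss : Real.sqrt ((σ - 1 / 2) ^ 2 - r ^ 2) ^ 2 = (σ - 1 / 2) ^ 2 - r ^ 2 :=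
    Real.sq_sqrt (by nlinarith)
  set v := Real.sqrt ((σ - 1 / 2) ^ 2 - r ^ 2)
  have hs1 : 0 < s - 1 := by rw [hs]; linarith
  have hexp : s - 2 * σ + r ^ 2 / (s - 1) = 0 := by
    field_simp
    rw [hs]
    linear_combination hss
  have hx : ∀ n : ℕ, (0 : ℝ) < (n : ℝ) + 1 := fun n => by positivity
  have hlog : ∀ n : ℕ, 0 ≤ Real.log ((n : ℝ) + 1) := fun n => Real.log_nonneg (by simp)
  set Z := ∑' n : ℕ, ENNReal.ofReal (((n : ℝ) + 1) ^ (-s)) with hZ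
  have hstep : ∀ k : ℕ, (∑' n : ℕ, b n * ENNReal.ofReal (((n : ℝ) + 1) ^ (-σ)) *
          ENNReal.ofReal (Real.log ((n : ℝ) + 1) ^ k / k.factorial)) ^ 2 ≤
      ENNReal.ofReal (1 / (s - 1) ^ k) * Z * ∑' n : ℕ, b n ^ 2 *
        ENNReal.ofReal (((n : ℝ) + 1) ^ (s - 2 * σ)) *
          ENNReal.ofReal (Real.log ((n : ℝ) + 1) ^ k / k.factorial) := by
    intro k
    have h := ENNReal.tsum_mul_sq_le
      (fun n : ℕ => ENNReal.ofReal (((n : ℝ) + 1) ^ (-s)) *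
        ENNReal.ofReal (Real.log ((n : ℝ) + 1) ^ k / k.factorial))
      (fun n => b n * ENNReal.ofReal (((n : ℝ) + 1) ^ (s - σ)))
    refine le_trans (le_of_eq ?_) (h.trans (mul_le_mul' (tsum_log_pow_le s (by linarith) k)
      (le_of_eq ?_)))
    · congr 1
      refine tsum_congr fun n => ?_
      rw [show -σ = -s + (s - σ) by ring, Real.rpow_add (hx n),
        ENNReal.ofReal_mul (Real.rpow_nonneg (hx n).le _)]
      ring
    · refine tsum_congr fun n => ?_
      rw [show s - 2 * σ = -s + ((s - σ) + (s - σ)) by ring, Real.rpow_add (hx n),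
        Real.rpow_add (hx n), ENNReal.ofReal_mul (Real.rpow_nonneg (hx n).le _),
        ENNReal.ofReal_mul (Real.rpow_nonneg (hx n).le _)]
      ring
  have hsum : ∀ n : ℕ, ENNReal.ofReal (((n : ℝ) + 1) ^ (s - 2 * σ)) *
      ∑' k : ℕ, ENNReal.ofReal (r ^ (2 * k)) * (ENNReal.ofReal (1 / (s - 1) ^ k) *
        ENNReal.ofReal (Real.log ((n : ℝ) + 1) ^ k / k.factorial)) = 1 := by
    intro n
    have hy : 0 ≤ r ^ 2 / (s - 1) * Real.log ((n : ℝ) + 1) := mul_nonneg (by positivity) (hlog n)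
    have h1 : ∑' k : ℕ, ENNReal.ofReal (r ^ (2 * k)) * (ENNReal.ofReal (1 / (s - 1) ^ k) *
        ENNReal.ofReal (Real.log ((n : ℝ) + 1) ^ k / k.factorial)) =
        ENNReal.ofReal (((n : ℝ) + 1) ^ (r ^ 2 / (s - 1))) := by
      rw [Real.rpow_def_of_pos (hx n), mul_comm (Real.log _), Real.exp_eq_exp_ℝ,
        NormedSpace.exp_eq_tsum_div, ENNReal.ofReal_tsum_of_nonneg (fun k => by positivity)
          (NormedSpace.expSeries_div_summable _)]
      refine tsum_congr fun k => ?_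
      rw [← ENNReal.ofReal_mul (by positivity), ← ENNReal.ofReal_mul (by positivity)]
      congr 1
      rw [mul_pow, div_pow, pow_mul]
      ring
    rw [h1, ← ENNReal.ofReal_mul (Real.rpow_nonneg (hx n).le _), ← Real.rpow_add (hx n), hexp]
    simp
  clear_value Z
  calc _ ≤ ∑' k : ℕ, ENNReal.ofReal (r ^ (2 * k)) * (ENNReal.ofReal (1 / (s - 1) ^ k) * Z *
        ∑' n : ℕ, b n ^ 2 * ENNReal.ofReal (((n : ℝ) + 1) ^ (s - 2 * σ)) *
          ENNReal.ofReal (Real.log ((n : ℝ) + 1) ^ k / k.factorial)) :=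
        ENNReal.tsum_le_tsum fun k => mul_le_mul_right (hstep k) _
    _ = Z * ∑' k : ℕ, ∑' n : ℕ, b n ^ 2 * (ENNReal.ofReal (((n : ℝ) + 1) ^ (s - 2 * σ)) *
          (ENNReal.ofReal (r ^ (2 * k)) * (ENNReal.ofReal (1 / (s - 1) ^ k) *
            ENNReal.ofReal (Real.log ((n : ℝ) + 1) ^ k / k.factorial)))) := by
        rw [← ENNReal.tsum_mul_left]
        refine tsum_congr fun k => ?_
        rw [← ENNReal.tsum_mul_left, ← ENNReal.tsum_mul_left, ← ENNReal.tsum_mul_left]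
        exact tsum_congr fun n => by ring
    _ = _ := by
        rw [ENNReal.tsum_comm]
        simp_rw [ENNReal.tsum_mul_left, hsum, mul_one]

theorem tsum_mul_rpow_sq_le (σ : ℝ) (b : ℕ → ℝ≥0∞) :
    (∑' n : ℕ, b n * ENNReal.ofReal (((n : ℝ) + 1) ^ (-σ))) ^ 2 ≤
      (∑' n : ℕ, ENNReal.ofReal (((n : ℝ) + 1) ^ (-(2 * σ)))) * ∑' n, b n ^ 2 := by
  have hx : ∀ n : ℕ, (0 : ℝ) < (n : ℝ) + 1 := fun n => by positivity
  have h := ENNReal.tsum_mul_sq_le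
    (fun n : ℕ => ENNReal.ofReal (((n : ℝ) + 1) ^ (-(2 * σ))))
    (fun n => b n * ENNReal.ofReal (((n : ℝ) + 1) ^ σ))
  refine le_trans (le_of_eq ?_) (h.trans (mul_le_mul_right (le_of_eq ?_) _))
  · congr 1
    refine tsum_congr fun n => ?_
    rw [show -σ = -(2 * σ) + σ by ring, Real.rpow_add (hx n),
      ENNReal.ofReal_mul (Real.rpow_nonneg (hx n).le _)]
    ring
  · refine tsum_congr fun n => ?_
    have : ENNReal.ofReal (((n : ℝ) + 1) ^ (-(2 * σ))) * ENNReal.ofReal (((n : ℝ) + 1) ^ σ) ^ 2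
        = 1 := by
      rw [sq, ← ENNReal.ofReal_mul (Real.rpow_nonneg (hx n).le _),
        ← ENNReal.ofReal_mul (Real.rpow_nonneg (hx n).le _), ← Real.rpow_add (hx n),
        ← Real.rpow_add (hx n), show -(2 * σ) + (σ + σ) = 0 by ring]
      simp
    rw [mul_pow, mul_left_comm, this, mul_one]

theorem ofReal_zetaR (s : ℝ) (hs : 1 < s) :
    ENNReal.ofReal (zetaR s) = ∑' n : ℕ, ENNReal.ofReal (((n : ℝ) + 1) ^ (-s)) := by
  refine ENNReal.ofReal_tsum_of_nonneg (fun n => by positivity) ?_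
  have h := (summable_nat_add_iff 1).2 (Real.summable_nat_rpow.2 (show -s < -1 by linarith))
  exact_mod_cast h

theorem zetaR_nonneg (s : ℝ) : 0 ≤ zetaR s := tsum_nonneg fun n => by positivity

theorem ofReal_term_le (c : ℂ) (cj : ℕ → ℂ) (a : ℕ → ℂ) (k : ℕ) :
    ENNReal.ofReal ((1 / (k.factorial : ℝ) ^ 2) *
        ‖∑' n : ℕ, a n * ((-Real.log ((n : ℝ) + 1) : ℝ) : ℂ) ^ k * ((n : ℂ) + 1) ^ (-c)‖ ^ 2 *
        MkInf cj k) ≤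
      (∑' n : ℕ, ‖a n‖ₑ * ENNReal.ofReal (((n : ℝ) + 1) ^ (-c.re)) *
          ENNReal.ofReal (Real.log ((n : ℝ) + 1) ^ k / k.factorial)) ^ 2 *
        multinomialSq (fun j => ‖cj j‖) k := by
  rw [ENNReal.ofReal_mul (by positivity)]
  refine mul_le_mul' ?_ (MkInf_le cj k)
  rw [← one_div_pow, ← mul_pow, ENNReal.ofReal_pow (by positivity),
    ENNReal.ofReal_mul (by positivity), ofReal_norm]
  gcongr
  refine (mul_le_mul_right enorm_tsum_le_tsum_enorm _).trans (le_of_eq ?_)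
  rw [← ENNReal.tsum_mul_left]
  refine tsum_congr fun n => ?_
  have hlog : 0 ≤ Real.log ((n : ℝ) + 1) := Real.log_nonneg (by simp)
  have h1 : ‖((n : ℂ) + 1) ^ (-c)‖ₑ = ENNReal.ofReal (((n : ℝ) + 1) ^ (-c.re)) := by
    rw [← ofReal_norm]
    congr 1
    have := Complex.norm_cpow_eq_rpow_re_of_pos (show (0 : ℝ) < (n : ℝ) + 1 by positivity) (-c)
    simpa using this
  have h2 : ‖((-Real.log ((n : ℝ) + 1) : ℝ) : ℂ) ^ k‖ₑ =
      ENNReal.ofReal (Real.log ((n : ℝ) + 1) ^ k) := by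
    rw [← ofReal_norm, norm_pow, Complex.norm_real, norm_neg, Real.norm_of_nonneg hlog]
  rw [enorm_mul, enorm_mul, h1, h2,
    div_eq_mul_one_div (Real.log _ ^ k), ENNReal.ofReal_mul (p := Real.log _ ^ k) (by positivity)]
  ring

/-- Norm bound for an affine symbol φ(s) = c + ∑_j c_j p_j^{−s}:
‖f∘φ‖² ≤ [(1−C)ζ(2Re c) + Cζ(1+ξ)]·‖f‖², with C = ∑|c_j|²/r² and
ξ = (Re c − 1/2) + √((Re c − 1/2)² − r²). -/
theorem stmt14 (c : ℂ) (hc : 1 / 2 < c.re) (cj : ℕ → ℂ)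
    (hsum : Summable fun j => ‖cj j‖)
    (hr0 : 0 < ∑' j : ℕ, ‖cj j‖) (hrc : (∑' j : ℕ, ‖cj j‖) ≤ c.re - 1 / 2)
    (a : ℕ → ℂ) (ha : Summable fun n => ‖a n‖ ^ 2) :
    ∑' k : ℕ, (1 / (k.factorial : ℝ) ^ 2) *
        ‖∑' n : ℕ, a n * ((-Real.log ((n : ℝ) + 1) : ℝ) : ℂ) ^ k * ((n : ℂ) + 1) ^ (-c)‖ ^ 2 *
        MkInf cj k ≤
      ((1 - (∑' j : ℕ, ‖cj j‖ ^ 2) / (∑' j : ℕ, ‖cj j‖) ^ 2) * zetaR (2 * c.re) +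
        ((∑' j : ℕ, ‖cj j‖ ^ 2) / (∑' j : ℕ, ‖cj j‖) ^ 2) *
          zetaR (1 + ((c.re - 1 / 2) +
            Real.sqrt ((c.re - 1 / 2) ^ 2 - (∑' j : ℕ, ‖cj j‖) ^ 2)))) *
        ∑' n : ℕ, ‖a n‖ ^ 2 := by
  set r := ∑' j : ℕ, ‖cj j‖ with hr
  set Q := ∑' j : ℕ, ‖cj j‖ ^ 2 with hQ
  set s := 1 + ((c.re - 1 / 2) + Real.sqrt ((c.re - 1 / 2) ^ 2 - r ^ 2)) with hs
  have hs1 : 1 < s := by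
    have := Real.sqrt_nonneg ((c.re - 1 / 2) ^ 2 - r ^ 2)
    rw [hs]; linarith
  have hrE : ∑' j, ENNReal.ofReal ‖cj j‖ = ENNReal.ofReal r :=
    (ENNReal.ofReal_tsum_of_nonneg (fun j => norm_nonneg _) hsum).symm
  have hle : ∀ j, ‖cj j‖ ^ 2 ≤ r * ‖cj j‖ := fun j => by
    rw [sq]
    exact mul_le_mul_of_nonneg_right (hsum.le_tsum j fun i _ => norm_nonneg _) (norm_nonneg _)
  have hsum2 : Summable fun j => ‖cj j‖ ^ 2 :=
    Summable.of_nonneg_of_le (fun j => sq_nonneg _) hle (hsum.mul_left r)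
  have hQE : ∑' j, ENNReal.ofReal ‖cj j‖ ^ 2 = ENNReal.ofReal Q := by
    rw [hQ, ENNReal.ofReal_tsum_of_nonneg (fun j => sq_nonneg _) hsum2]
    exact tsum_congr fun j => (ENNReal.ofReal_pow (norm_nonneg _) 2).symm
  have hQ0 : 0 ≤ Q := tsum_nonneg fun j => sq_nonneg _
  have hQr : Q ≤ r ^ 2 := by
    rw [sq, hQ]
    refine (hsum2.tsum_le_tsum hle (hsum.mul_left r)).trans (le_of_eq ?_)
    rw [tsum_mul_left]
  set C := Q / r ^ 2 with hC
  have hC0 : 0 ≤ C := by positivity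
  have hC1 : 0 ≤ 1 - C := sub_nonneg.2 (div_le_one_of_le₀ hQr (by positivity))
  have hCQ : Q = r ^ 2 * C := by rw [hC]; field_simp
  set A : ℕ → ℝ≥0∞ := fun k => (∑' n : ℕ, ‖a n‖ₑ * ENNReal.ofReal (((n : ℝ) + 1) ^ (-c.re)) *
          ENNReal.ofReal (Real.log ((n : ℝ) + 1) ^ k / k.factorial)) ^ 2 with hA
  have hM : ∀ k, multinomialSq (fun j => ‖cj j‖) (k + 1) ≤
      ENNReal.ofReal C * ENNReal.ofReal (r ^ (2 * (k + 1))) := fun k => by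
    refine (multinomialSq_succ_le_pow _ (fun j => norm_nonneg _) k).trans (le_of_eq ?_)
    rw [hrE, hQE, ← ENNReal.ofReal_pow hr0.le, ← ENNReal.ofReal_mul (by positivity),
      ← ENNReal.ofReal_mul hC0, hCQ]
    congr 1
    ring
  have hA0 : A 0 ≤ ENNReal.ofReal (zetaR (2 * c.re)) * ∑' n, ‖a n‖ₑ ^ 2 := by
    rw [ofReal_zetaR _ (by linarith)]
    simpa [hA] using tsum_mul_rpow_sq_le c.re fun n => ‖a n‖ₑ
  have hAs : ∑' k : ℕ, ENNReal.ofReal (r ^ (2 * k)) * A k ≤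
      ENNReal.ofReal (zetaR s) * ∑' n, ‖a n‖ₑ ^ 2 := by
    rw [ofReal_zetaR _ hs1]
    exact tsum_taylor_sq_le c.re r hc hr0.le hrc s hs fun n => ‖a n‖ₑ
  have hnorm : ∑' n, ‖a n‖ₑ ^ 2 = ENNReal.ofReal (∑' n, ‖a n‖ ^ 2) := by
    rw [ENNReal.ofReal_tsum_of_nonneg (fun j => sq_nonneg _) ha]
    exact tsum_congr fun n => by rw [ENNReal.ofReal_pow (norm_nonneg _), ofReal_norm]
  have hz1 := zetaR_nonneg (2 * c.re)
  have hz2 := zetaR_nonneg s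
  have ha0 : 0 ≤ ∑' n, ‖a n‖ ^ 2 := tsum_nonneg fun n => sq_nonneg _
  refine (ENNReal.ofReal_le_ofReal_iff (by positivity)).1 ?_
  refine (ofReal_tsum_le _ fun k => mul_nonneg (by positivity) (MkInf_nonneg cj k)).trans ?_
  have hsplit : A 0 = ENNReal.ofReal (1 - C) * A 0 + ENNReal.ofReal C * A 0 := by
    rw [← add_mul, ← ENNReal.ofReal_add hC1 hC0, sub_add_cancel, ENNReal.ofReal_one, one_mul]
  calc _ ≤ ∑' k, A k * multinomialSq (fun j => ‖cj j‖) k :=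
        ENNReal.tsum_le_tsum fun k => ofReal_term_le c cj a k
    _ = A 0 + ∑' k, A (k + 1) * multinomialSq (fun j => ‖cj j‖) (k + 1) := by
        rw [tsum_eq_zero_add' ENNReal.summable, multinomialSq_zero, mul_one]
    _ ≤ A 0 + ∑' k, A (k + 1) * (ENNReal.ofReal C * ENNReal.ofReal (r ^ (2 * (k + 1)))) := by
        gcongr with k
        exact hM k
    _ = ENNReal.ofReal (1 - C) * A 0 + ENNReal.ofReal C *
          ∑' k : ℕ, ENNReal.ofReal (r ^ (2 * k)) * A k := by
        rw [tsum_eq_zero_add' (f := fun k : ℕ => ENNReal.ofReal (r ^ (2 * k)) * A k)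
          ENNReal.summable, mul_add, ← add_assoc]
        simp only [mul_zero, pow_zero, ENNReal.ofReal_one, one_mul]
        rw [← hsplit, ← ENNReal.tsum_mul_left]
        congr 1
        exact tsum_congr fun k => by ring
    _ ≤ ENNReal.ofReal (1 - C) * (ENNReal.ofReal (zetaR (2 * c.re)) * ∑' n, ‖a n‖ₑ ^ 2) +
          ENNReal.ofReal C * (ENNReal.ofReal (zetaR s) * ∑' n, ‖a n‖ₑ ^ 2) := by
        gcongr
    _ = _ := by
        rw [hnorm, ENNReal.ofReal_mul (by positivity), ENNReal.ofReal_add (by positivity)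
          (by positivity), ENNReal.ofReal_mul hC1, ENNReal.ofReal_mul hC0]
        ring
end
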